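/- The generalized shift dynamical system (X^Γ, σ_φ) is topologically transitive if and only if φ : Γ → Γ is one-to-one and has no periodic point. -/

import Mathlib

open Filter Topology

/-- `d : Y → Y → ℝ` is a metric on the topological space `Y` compatible with
(i.e. inducing) its topology. -/
def IsCompatibleMetric (Y : Type*) [t : TopologicalSpace Y] (d : Y → Y → ℝ) : Prop :=
  ∃ m : MetricSpace Y, m.toUniformSpace.toTopologicalSpace = t ∧ ∀ a b, m.dist a b = d a b

/-- The generalized shift `σ_φ : X^Γ → X^Γ`, `σ_φ((x_α)_α) = (x_{φ(α)})_α`. -/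
def genShift {X Γ : Type*} (φ : Γ → Γ) (x : Γ → X) : Γ → X := fun α => x (φ α)

/-- `θ` is a quasi-periodic point of `φ` iff its forward orbit `{φ^n(θ) : n ≥ 0}` is finite. -/
def QuasiPeriodic {Γ : Type*} (φ : Γ → Γ) (θ : Γ) : Prop :=
  (Set.range fun n : ℕ => φ^[n] θ).Finite

/-- `θ` is a periodic point of `φ` iff `φ^n(θ) = θ` for some `n ≥ 1`. -/
def PeriodicPt {Γ : Type*} (φ : Γ → Γ) (θ : Γ) : Prop := ∃ n ≥ 1, φ^[n] θ = θ

/-- `ξ(x,y,t,n) = #{i ∈ {0,…,n−1} : d(f^i(x), f^i(y)) < t}`. -/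
noncomputable def xiCount {Y : Type*} (d : Y → Y → ℝ) (f : Y → Y) (x y : Y) (t : ℝ) (n : ℕ) :
    ℕ :=
  {i : ℕ | i < n ∧ d (f^[i] x) (f^[i] y) < t}.ncard

/-- `F_{xy}(t) = liminf_n ξ(x,y,t,n)/n`. -/
noncomputable def Fdist {Y : Type*} (d : Y → Y → ℝ) (f : Y → Y) (x y : Y) (t : ℝ) : ℝ :=
  liminf (fun n : ℕ => (xiCount d f x y t n : ℝ) / n) atTop

/-- `F*_{xy}(t) = limsup_n ξ(x,y,t,n)/n`. -/
noncomputable def FdistStar {Y : Type*} (d : Y → Y → ℝ) (f : Y → Y) (x y : Y) (t : ℝ) : ℝ :=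
  limsup (fun n : ℕ => (xiCount d f x y t n : ℝ) / n) atTop

/-- `ζ(x,y,γ_D,n) = #{i ∈ {0,…,n−1} : (f^i(x), f^i(y)) ∈ γ_D}` where
`γ_D = {(u,v) : u_α = v_α for all α ∈ D}`. -/
noncomputable def zetaCount {X Γ : Type*} (f : (Γ → X) → (Γ → X)) (x y : Γ → X) (D : Set Γ)
    (n : ℕ) : ℕ :=
  {i : ℕ | i < n ∧ ∀ α ∈ D, f^[i] x α = f^[i] y α}.ncard

/-- `G_{xy}(γ_D) = liminf_n ζ(x,y,γ_D,n)/n`. -/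
noncomputable def Gdist {X Γ : Type*} (f : (Γ → X) → (Γ → X)) (x y : Γ → X) (D : Set Γ) : ℝ :=
  liminf (fun n : ℕ => (zetaCount f x y D n : ℝ) / n) atTop

/-- `G*_{xy}(γ_D) = limsup_n ζ(x,y,γ_D,n)/n`. -/
noncomputable def GdistStar {X Γ : Type*} (f : (Γ → X) → (Γ → X)) (x y : Γ → X) (D : Set Γ) :
    ℝ :=
  limsup (fun n : ℕ => (zetaCount f x y D n : ℝ) / n) atTop

/-- `x, y` are distributionally scrambled of type 1 (w.r.t. the metric `d` and the map `f`). -/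
def DistScrambled1 {Y : Type*} (d : Y → Y → ℝ) (f : Y → Y) (x y : Y) : Prop :=
  (∃ s > 0, Fdist d f x y s = 0) ∧ ∀ s > 0, FdistStar d f x y s = 1

/-- `x, y` are distributionally scrambled of type 2. -/
def DistScrambled2 {Y : Type*} (d : Y → Y → ℝ) (f : Y → Y) (x y : Y) : Prop :=
  (∃ s > 0, Fdist d f x y s < 1) ∧ ∀ s > 0, FdistStar d f x y s = 1

/-- `x, y` are distributionally scrambled of type 3. -/
def DistScrambled3 {Y : Type*} (d : Y → Y → ℝ) (f : Y → Y) (x y : Y) : Prop :=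
  ∃ a b : ℝ, 0 < a ∧ a < b ∧ ∀ s ∈ Set.Icc a b, Fdist d f x y s < FdistStar d f x y s

/-- `A` is a distributionally scrambled set of type 1: it has at least two elements and all
pairs of distinct points of `A` are distributionally scrambled of type 1. -/
def DistScrambledSet1 {Y : Type*} (d : Y → Y → ℝ) (f : Y → Y) (A : Set Y) : Prop :=
  A.Nontrivial ∧ ∀ x ∈ A, ∀ y ∈ A, x ≠ y → DistScrambled1 d f x y

/-- `A` is a distributionally scrambled set of type 2. -/
def DistScrambledSet2 {Y : Type*} (d : Y → Y → ℝ) (f : Y → Y) (A : Set Y) : Prop :=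
  A.Nontrivial ∧ ∀ x ∈ A, ∀ y ∈ A, x ≠ y → DistScrambled2 d f x y

/-- `A` is a distributionally scrambled set of type 3. -/
def DistScrambledSet3 {Y : Type*} (d : Y → Y → ℝ) (f : Y → Y) (A : Set Y) : Prop :=
  A.Nontrivial ∧ ∀ x ∈ A, ∀ y ∈ A, x ≠ y → DistScrambled3 d f x y

/-- `(Y,f)` is uniform distributionally chaotic: there is an uncountable distributionally
scrambled set `A` of type 1 and a single `ε > 0` with `F_{xy}(ε) = 0` for distinct `x,y ∈ A`. -/
def UniformDC {Y : Type*} (d : Y → Y → ℝ) (f : Y → Y) : Prop :=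
  ∃ A : Set Y, ¬ A.Countable ∧ DistScrambledSet1 d f A ∧
    ∃ ε > 0, ∀ x ∈ A, ∀ y ∈ A, x ≠ y → Fdist d f x y ε = 0

/-- `a` is a transitive point of `f`: its forward orbit is dense. -/
def TransitivePoint {Y : Type*} [TopologicalSpace Y] (f : Y → Y) (a : Y) : Prop :=
  Dense (Set.range fun n : ℕ => f^[n] a)

/-- `(Y,f)` is dense distributionally chaotic: uniform distributional chaos witnessed by a
dense set. -/
def DenseDC {Y : Type*} [TopologicalSpace Y] (d : Y → Y → ℝ) (f : Y → Y) : Prop :=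
  ∃ A : Set Y, ¬ A.Countable ∧ Dense A ∧ DistScrambledSet1 d f A ∧
    ∃ ε > 0, ∀ x ∈ A, ∀ y ∈ A, x ≠ y → Fdist d f x y ε = 0

/-- `(Y,f)` is transitive distributionally chaotic: uniform distributional chaos witnessed by a
dense set of transitive points. -/
def TransitiveDC {Y : Type*} [TopologicalSpace Y] (d : Y → Y → ℝ) (f : Y → Y) : Prop :=
  ∃ A : Set Y, ¬ A.Countable ∧ Dense A ∧ (∀ a ∈ A, TransitivePoint f a) ∧
    DistScrambledSet1 d f A ∧
    ∃ ε > 0, ∀ x ∈ A, ∀ y ∈ A, x ≠ y → Fdist d f x y ε = 0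

/-- The ω-limit set of `a` under `f`: all limits of `f^[n k] a` along strictly increasing
sequences `n`. -/
def OmegaSet {Y : Type*} [TopologicalSpace Y] (f : Y → Y) (a : Y) : Set Y :=
  {z | ∃ n : ℕ → ℕ, StrictMono n ∧ Tendsto (fun k => f^[n k] a) atTop (nhds z)}

/-- The set of periodic points of `f`. -/
def PerSet {Y : Type*} (f : Y → Y) : Set Y := {y | ∃ n ≥ 1, f^[n] y = y}

/-- `x, y` are `ω^u`-scrambled. -/
def OmegaUScrambled {Y : Type*} [TopologicalSpace Y] (f : Y → Y) (x y : Y) : Prop :=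
  ¬ (OmegaSet f x \ OmegaSet f y).Countable ∧
    (OmegaSet f x ∩ OmegaSet f y).Nonempty ∧ (OmegaSet f x \ PerSet f).Nonempty

/-- `x, y` are `ω^∞`-scrambled. -/
def OmegaInfScrambled {Y : Type*} [TopologicalSpace Y] (f : Y → Y) (x y : Y) : Prop :=
  (OmegaSet f x \ OmegaSet f y).Infinite ∧
    (OmegaSet f x ∩ OmegaSet f y).Nonempty ∧ (OmegaSet f x \ PerSet f).Nonempty

/-- `A` is an `ω^u`-scrambled set. -/
def OmegaUScrambledSet {Y : Type*} [TopologicalSpace Y] (f : Y → Y) (A : Set Y) : Prop :=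
  A.Nontrivial ∧ ∀ x ∈ A, ∀ y ∈ A, x ≠ y → OmegaUScrambled f x y

/-- `A` is an `ω^∞`-scrambled set. -/
def OmegaInfScrambledSet {Y : Type*} [TopologicalSpace Y] (f : Y → Y) (A : Set Y) : Prop :=
  A.Nontrivial ∧ ∀ x ∈ A, ∀ y ∈ A, x ≠ y → OmegaInfScrambled f x y

theorem genShift_iterate_apply {X Γ : Type*} (φ : Γ → Γ) (n : ℕ) (x : Γ → X) (α : Γ) :
    (genShift φ)^[n] x α = x (φ^[n] α) := by
  induction n generalizing x with
  | zero => rfl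
  | succ n ih => rw [Function.iterate_succ_apply, ih, Function.iterate_succ_apply']; rfl

/-- If an injective map has no periodic point, then every orbit eventually avoids any given
point. -/
theorem eventually_iterate_ne {Γ : Type*} {φ : Γ → Γ} (hφ : Function.Injective φ)
    (hper : ∀ θ : Γ, ¬ PeriodicPt φ θ) (a b : Γ) : ∀ᶠ n in atTop, φ^[n] a ≠ b := by
  by_cases h : ∃ m, φ^[m] a = b
  · obtain ⟨m, rfl⟩ := h
    filter_upwards [eventually_gt_atTop m] with n hn heq
    refine hper a ⟨n - m, by omega, hφ.iterate m ?_⟩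
    rw [← Function.iterate_add_apply, Nat.add_sub_cancel' hn.le, heq]
  · exact Eventually.of_forall fun n hn => h ⟨n, hn⟩

/-- A nonempty open subset of a product contains all points that agree with a suitable point on a
suitable finite set of coordinates. -/
theorem exists_finset_forall_eqOn_mem {X Γ : Type*} [TopologicalSpace X] {U : Set (Γ → X)}
    (hU : IsOpen U) (hne : U.Nonempty) :
    ∃ (u : Γ → X) (F : Finset Γ), ∀ x : Γ → X, (∀ α ∈ F, x α = u α) → x ∈ U := by
  obtain ⟨u, hu⟩ := hne
  obtain ⟨F, t, ht, hsub⟩ := isOpen_pi_iff.1 hU u hu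
  exact ⟨u, F, fun x hx => hsub fun α hα => (hx α hα).symm ▸ (ht α hα).2⟩

theorem isOpen_setOf_apply_eq {X Γ : Type*} [TopologicalSpace X] [DiscreteTopology X]
    (α : Γ) (p : X) : IsOpen {x : Γ → X | x α = p} :=
  (isOpen_discrete {p}).preimage (f := fun x : Γ → X => x α) (continuous_apply α)

variable {X : Type*} [Fintype X] [TopologicalSpace X] [DiscreteTopology X] [Nontrivial X]
variable {Γ : Type*} [Countable Γ] [Nonempty Γ]
/-- `(X^Γ, σ_φ)` is topologically transitive iff `φ` is one-to-one and has no
periodic point. -/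
theorem transitive_iff_injective_and_no_periodicPt (φ : Γ → Γ) :
    (∀ U V : Set (Γ → X), IsOpen U → U.Nonempty → IsOpen V → V.Nonempty →
        ∃ n ≥ 1, ((genShift (X := X) φ)^[n] '' U ∩ V).Nonempty) ↔
      (Function.Injective φ ∧ ∀ θ : Γ, ¬ PeriodicPt φ θ) := by
  constructor
  · intro h
    obtain ⟨p, q, hpq⟩ := exists_pair_ne X
    refine ⟨fun a b hab => ?_, ?_⟩
    · classical
      by_contra hne
      obtain ⟨n, hn, _, ⟨x, -, rfl⟩, hxa, hxb⟩ := h Set.univ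
        ({x | x a = p} ∩ {x | x b = q}) isOpen_univ Set.univ_nonempty
        ((isOpen_setOf_apply_eq a p).inter (isOpen_setOf_apply_eq b q))
        ⟨fun c => if c = a then p else q, by simp, by simp [Ne.symm hne]⟩
      obtain ⟨m, rfl⟩ := Nat.exists_eq_add_of_le' hn
      simp only [Set.mem_ofPred_eq, genShift_iterate_apply] at hxa hxb
      rw [Function.iterate_succ_apply] at hxa hxb
      rw [hab] at hxa
      exact hpq (hxa.symm.trans hxb)
    · rintro θ ⟨n, hn, hθ⟩
      obtain ⟨m, -, _, ⟨x, hx, rfl⟩, hxq⟩ := h (⋂ i ∈ Finset.range n, {x | x (φ^[i] θ) = p})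
        {x | x θ = q} (isOpen_biInter_finset fun i _ => isOpen_setOf_apply_eq _ p)
        ⟨fun _ => p, by simp⟩ (isOpen_setOf_apply_eq θ q) ⟨fun _ => q, rfl⟩
      simp only [Set.mem_iInter, Finset.mem_range, Set.mem_ofPred_eq] at hx
      simp only [Set.mem_ofPred_eq, genShift_iterate_apply] at hxq
      have hmod : φ^[m % n] θ = φ^[m] θ := Function.IsPeriodicPt.iterate_mod_apply hθ m
      rw [← hmod, hx _ (Nat.mod_lt m hn)] at hxq
      exact hpq hxq
  · rintro ⟨hφ, hper⟩ U V hU hUne hV hVne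
    classical
    obtain ⟨u, F, hF⟩ := exists_finset_forall_eqOn_mem hU hUne
    obtain ⟨v, G, hG⟩ := exists_finset_forall_eqOn_mem hV hVne
    have hev : ∀ᶠ n in atTop, ∀ a ∈ G, ∀ b ∈ F, φ^[n] a ≠ b :=
      (eventually_all_finset G).2 fun a _ => (eventually_all_finset F).2 fun b _ =>
        eventually_iterate_ne hφ hper a b
    obtain ⟨n, hGF, hn⟩ := (hev.and (eventually_ge_atTop 1)).exists
    refine ⟨n, hn, _, ⟨F.piecewise u (Function.extend φ^[n] v u), hF _ fun α hα => ?_, rfl⟩,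
      hG _ fun α hα => ?_⟩
    · exact Finset.piecewise_eq_of_mem _ _ _ hα
    · rw [genShift_iterate_apply, Finset.piecewise_eq_of_notMem _ _ _ fun hmem =>
        hGF α hα _ hmem rfl, (hφ.iterate n).extend_apply]
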